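/- arXiv:2204.13218 — 7 statements merged into one kernel-verified Lean document; each statement's English description precedes it below -/
import Mathlib

section
/- Let ℐ ⊆ 𝒥 be an isotropic subspace. Then the set of singular instants {t ∈ ℝ : there exists J ∈ ℐ with J ≠ 0 and J(t) = 0} is discrete in ℝ (each of its points is isolated). -/
open scoped RealInnerProductSpace

noncomputable section

/-- Euclidean space `ℝ^n`. -/
abbrev Euc (n : ℕ) := EuclideanSpace ℝ (Fin n)

/-- `J : ℝ → ℝ^n` is a Jacobi field for the curvature family `R`:
it is twice differentiable and satisfies `J'' + R J = 0`. -/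
def IsJacobi {n : ℕ} (R : ℝ → (Euc n →L[ℝ] Euc n)) (J : ℝ → Euc n) : Prop :=
  Differentiable ℝ J ∧ Differentiable ℝ (deriv J) ∧
    ∀ t : ℝ, deriv (deriv J) t + R t (J t) = 0

/-- The (candidate) symplectic pairing of two fields, evaluated at time `t`. -/
def om {n : ℕ} (J₁ J₂ : ℝ → Euc n) (t : ℝ) : ℝ :=
  ⟪deriv J₁ t, J₂ t⟫ - ⟪J₁ t, deriv J₂ t⟫

open Filter Topology

/-- Forward Grönwall estimate for `‖f'‖ ≤ K ‖f‖`, comparing `f` with its initial value. -/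
theorem norm_sub_le_of_norm_deriv_le_forward {F : Type*} [NormedAddCommGroup F] [NormedSpace ℝ F]
    {f f' : ℝ → F} {K s t : ℝ} (hf : ∀ u, HasDerivAt f (f' u) u) (hK : 0 < K) (hst : s ≤ t)
    (hb : ∀ u ∈ Set.Icc s t, ‖f' u‖ ≤ K * ‖f u‖) :
    ‖f t - f s‖ ≤ ‖f s‖ * (Real.exp (K * (t - s)) - 1) := by
  have h := norm_le_gronwallBound_of_norm_deriv_right_le (f := fun u => f u - f s) (f' := f')
    (δ := 0) (K := K) (ε := K * ‖f s‖) (a := s) (b := t)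
    (fun u _ => ((hf u).sub_const (f s)).continuousAt.continuousWithinAt)
    (fun u _ => ((hf u).sub_const (f s)).hasDerivWithinAt) (by simp)
    (fun u hu => by
      have h₁ := hb u ⟨hu.1, hu.2.le⟩
      have h₂ : ‖f u‖ ≤ ‖f u - f s‖ + ‖f s‖ := norm_le_norm_sub_add (f u) (f s)
      nlinarith) t ⟨hst, le_rfl⟩
  rw [gronwallBound_of_K_ne_0 hK.ne'] at h
  have e : K * ‖f s‖ / K = ‖f s‖ := by field_simp
  simpa [e] using h

/-- Two-sided Grönwall estimate for `‖f'‖ ≤ K ‖f‖`. -/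
theorem norm_sub_le_of_norm_deriv_le {F : Type*} [NormedAddCommGroup F] [NormedSpace ℝ F]
    {f f' : ℝ → F} {K s t : ℝ} (hf : ∀ u, HasDerivAt f (f' u) u) (hK : 0 < K)
    (hb : ∀ u ∈ Set.uIcc s t, ‖f' u‖ ≤ K * ‖f u‖) :
    ‖f t - f s‖ ≤ ‖f s‖ * (Real.exp (K * |t - s|) - 1) := by
  rcases le_total s t with h | h
  · rw [abs_of_nonneg (sub_nonneg.2 h)]
    rw [Set.uIcc_of_le h] at hb
    exact norm_sub_le_of_norm_deriv_le_forward hf hK h hb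
  · rw [abs_of_nonpos (sub_nonpos.2 h)]
    rw [Set.uIcc_of_ge h] at hb
    have hr : ∀ u, HasDerivAt (fun u => f (-u)) (-f' (-u)) u := fun u => by
      simpa [Function.comp_def] using (hf (-u)).scomp u (hasDerivAt_neg u)
    have := norm_sub_le_of_norm_deriv_le_forward hr hK (neg_le_neg h) (fun u hu => by
      simpa using hb (-u) ⟨by linarith [hu.2], by linarith [hu.1]⟩)
    simpa [neg_add_eq_sub] using this

namespace IsJacobi

variable {n : ℕ} {R : ℝ → (Euc n →L[ℝ] Euc n)} {J J₁ J₂ : ℝ → Euc n}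

theorem hasDerivAt (h : IsJacobi R J) (t : ℝ) : HasDerivAt J (deriv J t) t :=
  (h.1 t).hasDerivAt

theorem hasDerivAt_deriv (h : IsJacobi R J) (t : ℝ) :
    HasDerivAt (deriv J) (-R t (J t)) t := by
  rw [← eq_neg_of_add_eq_zero_left (h.2.2 t)]
  exact (h.2.1 t).hasDerivAt

/-- The symplectic pairing of two Jacobi fields does not depend on time. -/
theorem om_eq (hsym : ∀ t : ℝ, ∀ v w : Euc n, ⟪R t v, w⟫ = ⟪v, R t w⟫)
    (h₁ : IsJacobi R J₁) (h₂ : IsJacobi R J₂) (s t : ℝ) : om J₁ J₂ s = om J₁ J₂ t := by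
  have hd : ∀ u, HasDerivAt (om J₁ J₂) 0 u := fun u => by
    have := ((h₁.hasDerivAt_deriv u).inner ℝ (h₂.hasDerivAt u)).sub
      ((h₁.hasDerivAt u).inner ℝ (h₂.hasDerivAt_deriv u))
    refine this.congr_deriv ?_
    simp only [inner_neg_left, inner_neg_right, hsym]
    ring
  exact is_const_of_deriv_eq_zero (fun u => (hd u).differentiableAt) (fun u => (hd u).deriv) s t

/-- Grönwall estimate for the phase-space curve `(J, J')`. -/
theorem norm_phase_sub_le {K s t : ℝ} (h : IsJacobi R J) (hK : 1 ≤ K)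
    (hb : ∀ u ∈ Set.uIcc s t, ‖R u‖ ≤ K) :
    ‖(J t, deriv J t) - (J s, deriv J s)‖ ≤
      ‖(J s, deriv J s)‖ * (Real.exp (K * |t - s|) - 1) := by
  refine norm_sub_le_of_norm_deriv_le (f := fun u => (J u, deriv J u))
    (fun u => (h.hasDerivAt u).prodMk (h.hasDerivAt_deriv u)) (by linarith) fun u hu => ?_
  have h₁ : ‖J u‖ ≤ ‖(J u, deriv J u)‖ := norm_fst_le (J u, deriv J u)
  have h₂ : ‖deriv J u‖ ≤ ‖(J u, deriv J u)‖ := norm_snd_le (J u, deriv J u)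
  refine norm_prod_le_iff.2 ⟨?_, ?_⟩
  · exact h₂.trans (le_mul_of_one_le_left (norm_nonneg _) hK)
  · rw [norm_neg]
    exact ((R u).le_opNorm _).trans
      (mul_le_mul (hb u hu) h₁ (norm_nonneg _) (by linarith))

/-- A Jacobi field with vanishing initial data vanishes identically. -/
theorem eq_zero (hR : Continuous R) (h : IsJacobi R J) {t : ℝ} (h₀ : J t = 0)
    (h₁ : deriv J t = 0) : J = 0 := by
  funext s
  obtain ⟨C, hC⟩ := (isCompact_uIcc (a := t) (b := s)).exists_bound_of_continuousOn
    hR.continuousOn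
  have := h.norm_phase_sub_le (le_max_left 1 C) fun u hu => (hC u hu).trans (le_max_right 1 C)
  simp only [h₀, h₁, Prod.mk_zero_zero, sub_zero, norm_zero, zero_mul] at this
  exact congrArg Prod.fst (norm_le_zero_iff.1 this)

end IsJacobi

/-- Evaluation of the phase-space curve `(J, J')` at time `t` on a space of differentiable
fields. -/
def phaseEval {n : ℕ} (ℐ : Submodule ℝ (ℝ → Euc n)) (hd : ∀ J ∈ ℐ, Differentiable ℝ J) (t : ℝ) :
    ℐ →ₗ[ℝ] Euc n × Euc n where
  toFun J := (J.1 t, deriv J.1 t)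
  map_add' J₁ J₂ := by
    simp [deriv_add (hd _ J₁.2 t) (hd _ J₂.2 t)]
  map_smul' c J := by
    simp [deriv_const_smul c (hd _ J.2 t)]

theorem stmt_3 {n : ℕ} (hn : 1 ≤ n) (R : ℝ → (Euc n →L[ℝ] Euc n))
    (hRcont : Continuous R)
    (hRsym : ∀ t : ℝ, ∀ v w : Euc n, ⟪R t v, w⟫ = ⟪v, R t w⟫)
    (ℐ : Submodule ℝ (ℝ → Euc n))
    (hℐJ : ∀ J ∈ ℐ, IsJacobi R J)
    (hiso : ∀ J₁ ∈ ℐ, ∀ J₂ ∈ ℐ, om J₁ J₂ 0 = 0) :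
    ∀ t₀ ∈ {t : ℝ | ∃ J ∈ ℐ, J ≠ 0 ∧ J t = 0},
      ∃ ε > 0, ∀ t ∈ {t : ℝ | ∃ J ∈ ℐ, J ≠ 0 ∧ J t = 0}, |t - t₀| < ε → t = t₀ := by
  intro t₀ _
  by_contra! hcon
  have hseq : ∀ k : ℕ, ∃ t : ℝ, ∃ J ∈ ℐ, J t = 0 ∧ ‖deriv J t‖ = 1 ∧
      |t - t₀| < 1 / ((k : ℝ) + 1) ∧ t ≠ t₀ := by
    intro k
    obtain ⟨t, ⟨J, hJ, hJ0, hJt⟩, hlt, hne⟩ := hcon (1 / ((k : ℝ) + 1)) (by positivity)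
    have hd : deriv J t ≠ 0 := fun h => hJ0 ((hℐJ J hJ).eq_zero hRcont hJt h)
    refine ⟨t, ‖deriv J t‖⁻¹ • J, ℐ.smul_mem _ hJ, by simp [hJt], ?_, hlt, hne⟩
    rw [deriv_const_smul _ ((hℐJ J hJ).1 t), norm_smul, norm_inv, norm_norm,
      inv_mul_cancel₀ (norm_ne_zero_iff.2 hd)]
  choose t J hJ hJt hnorm hlt hne using hseq
  obtain ⟨v, hv, φ, hφ, hlim⟩ := (isCompact_sphere (0 : Euc n) 1).tendsto_subseq
    (x := fun k => deriv (J k) (t k)) (fun k => by simp [hnorm k])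
  have habs : Tendsto (fun k => |t k - t₀|) atTop (𝓝 0) :=
    squeeze_zero (fun _ => abs_nonneg _) (fun k => (hlt k).le)
      tendsto_one_div_add_atTop_nhds_zero_nat
  have ht : Tendsto t atTop (𝓝 t₀) := by
    rw [tendsto_iff_dist_tendsto_zero]
    simpa [Real.dist_eq] using habs
  obtain ⟨C, hC⟩ := (isCompact_Icc (a := t₀ - 1) (b := t₀ + 1)).exists_bound_of_continuousOn
    hRcont.continuousOn
  -- the phase-space points of `J k` at `t₀` and at `t k` are asymptotically equal
  have hphase : Tendsto (fun k => (J k t₀, deriv (J k) t₀) - (J k (t k), deriv (J k) (t k)))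
      atTop (𝓝 0) := by
    have hexp : Tendsto (fun k => Real.exp (max 1 C * |t k - t₀|) - 1) atTop (𝓝 0) := by
      have := ((Real.continuous_exp.tendsto _).comp (habs.const_mul (max 1 C))).sub_const 1
      simpa using this
    refine squeeze_zero_norm (fun k => ?_) hexp
    have hk : |t k - t₀| ≤ 1 := (hlt k).le.trans
      ((div_le_one (by positivity)).2 (by linarith [Nat.cast_nonneg (α := ℝ) k]))
    have hmem : t k ∈ Set.Icc (t₀ - 1) (t₀ + 1) :=
      ⟨by linarith [(abs_le.1 hk).1], by linarith [(abs_le.1 hk).2]⟩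
    have := (hℐJ _ (hJ k)).norm_phase_sub_le (s := t k) (t := t₀) (le_max_left 1 C)
      fun u hu => (hC u (Set.uIcc_subset_Icc hmem ⟨by linarith, by linarith⟩ hu)).trans
        (le_max_right 1 C)
    have hone : ‖(J k (t k), deriv (J k) (t k))‖ = 1 := by
      rw [Prod.norm_mk, hJt, hnorm]; simp
    rwa [hone, one_mul, abs_sub_comm] at this
  -- by closedness of finite-dimensional subspaces, the limit is realised by a field in `ℐ`
  have hrange : ((0 : Euc n), v) ∈
      LinearMap.range (phaseEval ℐ (fun J hJ => (hℐJ J hJ).1) t₀) := by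
    refine (Submodule.closed_of_finiteDimensional _).mem_of_tendsto (b := atTop)
      (f := fun k => (J (φ k) t₀, deriv (J (φ k)) t₀)) ?_
      (Eventually.of_forall fun k => ⟨⟨J (φ k), hJ _⟩, rfl⟩)
    have h := (hphase.comp hφ.tendsto_atTop).add
      ((tendsto_const_nhds (x := (0 : Euc n))).prodMk_nhds hlim)
    rw [zero_add] at h
    refine h.congr fun k => ?_
    simp [hJt]
  obtain ⟨⟨L, hL⟩, hLeq⟩ := hrange
  have hL0 : L t₀ = 0 := congrArg Prod.fst hLeq
  have hL1 : deriv L t₀ = v := congrArg Prod.snd hLeq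
  have hslope : Tendsto (fun k => slope L t₀ (t (φ k))) atTop (𝓝 v) := by
    rw [← hL1]
    exact (hasDerivAt_iff_tendsto_slope.1 ((hℐJ L hL).hasDerivAt t₀)).comp
      (tendsto_nhdsWithin_iff.2
        ⟨ht.comp hφ.tendsto_atTop, Eventually.of_forall fun k => hne (φ k)⟩)
  have hzero : ∀ k, ⟪deriv (J (φ k)) (t (φ k)), slope L t₀ (t (φ k))⟫ = 0 := fun k => by
    have h := (hℐJ _ (hJ (φ k))).om_eq hRsym (hℐJ L hL) (t (φ k)) 0
    rw [hiso _ (hJ _) _ hL, om, hJt, inner_zero_left, sub_zero] at h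
    rw [slope_def_module, hL0, sub_zero, inner_smul_right, h, mul_zero]
  have hvv : ⟪v, v⟫ = 0 := tendsto_nhds_unique
    ((hlim.inner hslope).congr hzero) tendsto_const_nhds
  have hv1 : ‖v‖ = 1 := by simpa using hv
  rw [inner_self_eq_zero.1 hvv, norm_zero] at hv1
  exact zero_ne_one hv1
end
end

section
/- Fix a ∈ ℝ, a linear subspace W ⊆ E, and a linear map S : E → E satisfying ⟨S w₁, w₂⟩ = ⟨w₁, S w₂⟩ for all w₁, w₂ ∈ W (an abstract shape operator). Then the space of W-Jacobi fields L := {J ∈ 𝒥 : J(a) ∈ W and J'(a) − S(J(a)) ∈ W^⊥} is a Lagrangian subspace of 𝒥: ω vanishes identically on L and dim L = n. -/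
open scoped RealInnerProductSpace

noncomputable section

/-- The set of `W`-Jacobi fields for the abstract shape operator `S`. -/
def LJac {n : ℕ} (R : ℝ → (Euc n →L[ℝ] Euc n)) (a : ℝ) (W : Submodule ℝ (Euc n))
    (S : Euc n →ₗ[ℝ] Euc n) : Set (ℝ → Euc n) :=
  {J : ℝ → Euc n | IsJacobi R J ∧ J a ∈ W ∧ deriv J a - S (J a) ∈ Wᗮ}

section LinearODE

variable {F : Type*} [NormedAddCommGroup F] [NormedSpace ℝ F]

/-- The terms of the Picard series of `x' = A x`, `x a = x₀`. -/
def picardTerm (A : ℝ → F →L[ℝ] F) (a : ℝ) (x₀ : F) : ℕ → ℝ → F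
  | 0 => fun _ => x₀
  | k + 1 => fun t => ∫ s in a..t, A s (picardTerm A a x₀ k s)

theorem continuous_picardTerm {A : ℝ → F →L[ℝ] F} (hA : Continuous A) (a : ℝ) (x₀ : F) (k : ℕ) :
    Continuous (picardTerm A a x₀ k) := by
  induction k with
  | zero => exact continuous_const
  | succ k ih =>
    exact intervalIntegral.continuous_primitive
      (fun _ _ => (hA.clm_apply ih).intervalIntegrable _ _) a

theorem hasDerivAt_picardTerm_succ [CompleteSpace F] {A : ℝ → F →L[ℝ] F} (hA : Continuous A)
    (a : ℝ) (x₀ : F) (k : ℕ) (t : ℝ) :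
    HasDerivAt (picardTerm A a x₀ (k + 1)) (A t (picardTerm A a x₀ k t)) t :=
  (hA.clm_apply (continuous_picardTerm hA a x₀ k)).integral_hasStrictDerivAt a t |>.hasDerivAt

theorem norm_picardTerm_le {A : ℝ → F →L[ℝ] F} {a T C : ℝ} (x₀ : F)
    (hC : ∀ s ∈ Metric.ball a T, ‖A s‖ ≤ C) (k : ℕ) {t : ℝ} (ht : t ∈ Metric.ball a T) :
    ‖picardTerm A a x₀ k t‖ ≤ ‖x₀‖ * C ^ k / k.factorial * |t - a| ^ k := by
  induction k generalizing t with
  | zero => simp [picardTerm]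
  | succ k ih =>
    have hC₀ : 0 ≤ C := (norm_nonneg _).trans (hC t ht)
    have hsub : ∀ s ∈ Set.uIoc a t, s ∈ Metric.ball a T := fun s hs => by
      have haT : a ∈ Metric.ball a T := Metric.mem_ball_self (dist_nonneg.trans_lt ht)
      exact ((convex_ball a T).ordConnected.uIcc_subset haT ht) (Set.uIoc_subset_uIcc hs)
    have hint : ∀ s ∈ Set.uIoc a t, ‖A s (picardTerm A a x₀ k s)‖ ≤
        C * (‖x₀‖ * C ^ k / k.factorial) * |s - a| ^ k := fun s hs =>
      calc ‖A s (picardTerm A a x₀ k s)‖ ≤ ‖A s‖ * ‖picardTerm A a x₀ k s‖ := (A s).le_opNorm _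
        _ ≤ C * (‖x₀‖ * C ^ k / k.factorial * |s - a| ^ k) := by
          gcongr
          · exact hC s (hsub s hs)
          · exact ih (hsub s hs)
        _ = _ := by ring
    have hcont : Continuous fun s : ℝ => C * (‖x₀‖ * C ^ k / k.factorial) * |s - a| ^ k := by
      fun_prop
    calc ‖picardTerm A a x₀ (k + 1) t‖
        ≤ ∫ s in Set.uIoc a t, ‖A s (picardTerm A a x₀ k s)‖ :=
          intervalIntegral.norm_integral_le_integral_norm_uIoc
      _ ≤ ∫ s in Set.uIoc a t, C * (‖x₀‖ * C ^ k / k.factorial) * |s - a| ^ k := by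
          refine MeasureTheory.integral_mono_of_nonneg (.of_forall fun _ => norm_nonneg _)
            (hcont.integrableOn_uIoc) ?_
          exact (MeasureTheory.ae_restrict_iff' measurableSet_uIoc).2 (.of_forall hint)
      _ = ‖x₀‖ * C ^ (k + 1) / (k + 1).factorial * |t - a| ^ (k + 1) := by
          rw [MeasureTheory.integral_const_mul, integral_pow_abs_sub_uIoc, Nat.factorial_succ]
          push_cast
          field_simp
          ring

/-- Global existence for linear ordinary differential equations with continuous coefficients. -/
theorem exists_hasDerivAt_linear [CompleteSpace F] {A : ℝ → F →L[ℝ] F} (hA : Continuous A)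
    (a : ℝ) (x₀ : F) : ∃ x : ℝ → F, x a = x₀ ∧ ∀ t, HasDerivAt x (A t (x t)) t := by
  set p := picardTerm A a x₀ with hp
  have hpa : ∀ k, p (k + 1) a = 0 := fun k => intervalIntegral.integral_same
  refine ⟨fun t => x₀ + ∑' k, p (k + 1) t, by simp [hpa], fun t => ?_⟩
  obtain ⟨T, hT⟩ : ∃ T, T = |t - a| + 1 := ⟨_, rfl⟩
  have hT₀ : 0 < T := by rw [hT]; positivity
  have ht : t ∈ Metric.ball a T := by rw [Metric.mem_ball, Real.dist_eq]; linarith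
  obtain ⟨C, hC⟩ := (isCompact_closedBall a T).exists_bound_of_continuousOn hA.continuousOn
  have hC' : ∀ s ∈ Metric.ball a T, ‖A s‖ ≤ C := fun s hs => hC s (Metric.ball_subset_closedBall hs)
  have hC₀ : 0 ≤ C := (norm_nonneg _).trans (hC' t ht)
  have hbound : ∀ k, ∀ s ∈ Metric.ball a T,
      ‖p k s‖ ≤ ‖x₀‖ * ((C * T) ^ k / k.factorial) := fun k s hs =>
    calc ‖p k s‖ ≤ ‖x₀‖ * C ^ k / k.factorial * |s - a| ^ k := norm_picardTerm_le x₀ hC' k hs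
      _ ≤ ‖x₀‖ * C ^ k / k.factorial * T ^ k := by
        gcongr
        exact (Metric.mem_ball.1 hs).le
      _ = _ := by rw [mul_pow]; ring
  have hsum : Summable fun k : ℕ => ‖x₀‖ * ((C * T) ^ k / k.factorial) :=
    (Real.summable_pow_div_factorial _).mul_left _
  have hsum_p : Summable fun k => p k t :=
    Summable.of_norm_bounded hsum fun k => hbound k t ht
  have hderiv := hasDerivAt_tsum_of_isPreconnected (hsum.mul_left C) Metric.isOpen_ball
    (convex_ball a T).isPreconnected
    (fun k s _ => hasDerivAt_picardTerm_succ hA a x₀ k s)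
    (fun k s hs => ((A s).le_opNorm _).trans
      (mul_le_mul (hC' s hs) (hbound k s hs) (norm_nonneg _) hC₀))
    (Metric.mem_ball_self hT₀) (by simp [← hp, hpa]) ht
  have hval : A t (x₀ + ∑' k, p (k + 1) t) = ∑' k, A t (p k t) := by
    rw [← (A t).map_tsum hsum_p, hsum_p.tsum_eq_zero_add]
    rfl
  simpa only [hval] using hderiv.const_add x₀

end LinearODE

section Jacobi

variable {n : ℕ} {R : ℝ → (Euc n →L[ℝ] Euc n)}

theorem exists_isJacobi (hR : Continuous R) (a : ℝ) (u v : Euc n) :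
    ∃ J, IsJacobi R J ∧ J a = u ∧ deriv J a = v := by
  let A : ℝ → (Euc n × Euc n →L[ℝ] Euc n × Euc n) := fun t =>
    (ContinuousLinearMap.inl ℝ _ _).comp (ContinuousLinearMap.snd ℝ _ _) -
      (ContinuousLinearMap.inr ℝ _ _).comp ((R t).comp (ContinuousLinearMap.fst ℝ _ _))
  have hA : Continuous A :=
    continuous_const.sub (continuous_const.clm_comp (hR.clm_comp continuous_const))
  obtain ⟨x, hxa, hx⟩ := exists_hasDerivAt_linear hA a (u, v)
  have h₁ : ∀ t, HasDerivAt (fun s => (x s).1) (x t).2 t := fun t => by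
    refine ((hasFDerivAt_fst (𝕜 := ℝ) (p := x t)).comp_hasDerivAt t (hx t)).congr_deriv ?_
    simp [A]
  have h₂ : ∀ t, HasDerivAt (fun s => (x s).2) (-R t (x t).1) t := fun t => by
    refine ((hasFDerivAt_snd (𝕜 := ℝ) (p := x t)).comp_hasDerivAt t (hx t)).congr_deriv ?_
    simp [A]
  have hd : deriv (fun s => (x s).1) = fun s => (x s).2 := funext fun t => (h₁ t).deriv
  refine ⟨fun s => (x s).1, ⟨fun t => (h₁ t).differentiableAt, ?_, fun t => ?_⟩, ?_, ?_⟩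
  · rw [hd]
    exact fun t => (h₂ t).differentiableAt
  · rw [hd, (h₂ t).deriv, neg_add_cancel]
  · simp [hxa]
  · rw [hd]
    simp [hxa]

theorem IsJacobi.om_eq_s5 (hRsym : ∀ t : ℝ, ∀ v w : Euc n, ⟪R t v, w⟫ = ⟪v, R t w⟫)
    {J₁ J₂ : ℝ → Euc n} (h₁ : IsJacobi R J₁) (h₂ : IsJacobi R J₂) (s t : ℝ) :
    om J₁ J₂ s = om J₁ J₂ t := by
  have key : ∀ r, HasDerivAt (om J₁ J₂) 0 r := fun r => by
    have e₁ : deriv (deriv J₁) r = -R r (J₁ r) := eq_neg_of_add_eq_zero_left (h₁.2.2 r)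
    have e₂ : deriv (deriv J₂) r = -R r (J₂ r) := eq_neg_of_add_eq_zero_left (h₂.2.2 r)
    have := ((h₁.2.1 r).hasDerivAt.inner ℝ (h₂.1 r).hasDerivAt).sub
      ((h₁.1 r).hasDerivAt.inner ℝ (h₂.2.1 r).hasDerivAt)
    refine this.congr_deriv ?_
    rw [e₁, e₂, inner_neg_left, inner_neg_right, hRsym]
    ring
  exact is_const_of_deriv_eq_zero (fun r => (key r).differentiableAt) (fun r => (key r).deriv) s t

/-- A Jacobi field with trivial Cauchy data vanishes: it is `om`-orthogonal to every Jacobi field,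
and these realize all Cauchy data at every time. -/
theorem IsJacobi.eq_zero_s5 (hR : Continuous R)
    (hRsym : ∀ t : ℝ, ∀ v w : Euc n, ⟪R t v, w⟫ = ⟪v, R t w⟫)
    {J : ℝ → Euc n} (hJ : IsJacobi R J) {a : ℝ} (h₀ : J a = 0) (h₁ : deriv J a = 0) : J = 0 := by
  funext t
  obtain ⟨K, hK, hKt, hKt'⟩ := exists_isJacobi hR t 0 (J t)
  have h := hJ.om_eq_s5 hRsym hK t a
  simpa [om, h₀, h₁, hKt, hKt'] using h

theorem IsJacobi.add {J₁ J₂ : ℝ → Euc n} (h₁ : IsJacobi R J₁) (h₂ : IsJacobi R J₂) :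
    IsJacobi R (J₁ + J₂) := by
  have hd : deriv (J₁ + J₂) = deriv J₁ + deriv J₂ := funext fun t => deriv_add (h₁.1 t) (h₂.1 t)
  refine ⟨h₁.1.add h₂.1, hd ▸ h₁.2.1.add h₂.2.1, fun t => ?_⟩
  rw [hd, deriv_add (h₁.2.1 t) (h₂.2.1 t), Pi.add_apply, map_add, add_add_add_comm,
    h₁.2.2, h₂.2.2, add_zero]

theorem IsJacobi.const_smul {J : ℝ → Euc n} (h : IsJacobi R J) (c : ℝ) : IsJacobi R (c • J) := by
  have hd : deriv (c • J) = c • deriv J := funext fun t => deriv_const_smul c (h.1 t)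
  refine ⟨h.1.const_smul c, hd ▸ h.2.1.const_smul c, fun t => ?_⟩
  rw [hd, deriv_const_smul c (h.2.1 t), Pi.smul_apply, map_smul, ← smul_add, h.2.2, smul_zero]

theorem isJacobi_zero : IsJacobi R 0 := by
  have hd : deriv (0 : ℝ → Euc n) = 0 := funext fun t => deriv_const t 0
  exact ⟨differentiable_const 0, by rw [hd]; exact differentiable_const 0, fun t => by simp [hd]⟩

/-- The `W`-Jacobi fields as a subspace of the space of curves. -/
def LJacSubmodule (R : ℝ → (Euc n →L[ℝ] Euc n)) (a : ℝ) (W : Submodule ℝ (Euc n))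
    (S : Euc n →ₗ[ℝ] Euc n) : Submodule ℝ (ℝ → Euc n) where
  carrier := LJac R a W S
  zero_mem' := ⟨isJacobi_zero, W.zero_mem, by
    have hd : deriv (0 : ℝ → Euc n) a = 0 := deriv_const a 0
    simp [hd]⟩
  add_mem' := by
    rintro J₁ J₂ ⟨h₁, hW₁, hS₁⟩ ⟨h₂, hW₂, hS₂⟩
    refine ⟨h₁.add h₂, W.add_mem hW₁ hW₂, ?_⟩
    rw [deriv_add (h₁.1 a) (h₂.1 a), Pi.add_apply, map_add, add_sub_add_comm]
    exact Wᗮ.add_mem hS₁ hS₂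
  smul_mem' := by
    rintro c J ⟨h, hW, hS⟩
    refine ⟨h.const_smul c, W.smul_mem c hW, ?_⟩
    rw [deriv_const_smul c (h.1 a), Pi.smul_apply, map_smul, ← smul_sub]
    exact Wᗮ.smul_mem c hS

/-- The Cauchy data `(J a, J' a - S (J a))` of a `W`-Jacobi field. -/
def cauchyData (R : ℝ → (Euc n →L[ℝ] Euc n)) (a : ℝ) (W : Submodule ℝ (Euc n))
    (S : Euc n →ₗ[ℝ] Euc n) : LJacSubmodule R a W S →ₗ[ℝ] W × Wᗮ where
  toFun J := (⟨J.1 a, J.2.2.1⟩, ⟨deriv J.1 a - S (J.1 a), J.2.2.2⟩)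
  map_add' J₁ J₂ := by
    ext1 <;> apply Subtype.ext
    · rfl
    · simp [deriv_add (J₁.2.1.1 a) (J₂.2.1.1 a), add_sub_add_comm]
  map_smul' c J := by
    ext1 <;> apply Subtype.ext
    · rfl
    · simp [deriv_const_smul c (J.2.1.1 a), smul_sub]

theorem cauchyData_bijective (hR : Continuous R)
    (hRsym : ∀ t : ℝ, ∀ v w : Euc n, ⟪R t v, w⟫ = ⟪v, R t w⟫)
    (a : ℝ) (W : Submodule ℝ (Euc n)) (S : Euc n →ₗ[ℝ] Euc n) :
    Function.Bijective (cauchyData R a W S) := by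
  constructor
  · refine (injective_iff_map_eq_zero _).2 fun J hJ => Subtype.ext ?_
    have h₀ : J.1 a = 0 := congrArg (fun p => (p.1 : Euc n)) hJ
    have h₁ : deriv J.1 a - S (J.1 a) = 0 := congrArg (fun p => (p.2 : Euc n)) hJ
    rw [h₀, map_zero, sub_zero] at h₁
    exact J.2.1.eq_zero_s5 hR hRsym h₀ h₁
  · rintro ⟨u, v⟩
    obtain ⟨J, hJ, hu, hv⟩ := exists_isJacobi hR a u (v + S u)
    have hd : deriv J a - S (J a) = v := by rw [hv, hu, add_sub_cancel_right]
    exact ⟨⟨J, hJ, hu ▸ u.2, hd ▸ v.2⟩, Prod.ext (Subtype.ext hu) (Subtype.ext hd)⟩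

theorem om_eq_zero_of_mem_LJac {a : ℝ} {W : Submodule ℝ (Euc n)} {S : Euc n →ₗ[ℝ] Euc n}
    (hS : ∀ w₁ ∈ W, ∀ w₂ ∈ W, ⟪S w₁, w₂⟫ = ⟪w₁, S w₂⟫) {J₁ J₂ : ℝ → Euc n}
    (h₁ : J₁ ∈ LJac R a W S) (h₂ : J₂ ∈ LJac R a W S) : om J₁ J₂ a = 0 := by
  have e₁ := Submodule.inner_left_of_mem_orthogonal h₂.2.1 h₁.2.2
  have e₂ := Submodule.inner_right_of_mem_orthogonal h₁.2.1 h₂.2.2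
  rw [inner_sub_left] at e₁
  rw [inner_sub_right] at e₂
  rw [om]
  linarith [hS _ h₁.2.1 _ h₂.2.1]

end Jacobi

theorem stmt_5 {n : ℕ} (hn : 1 ≤ n) (R : ℝ → (Euc n →L[ℝ] Euc n))
    (hRcont : Continuous R)
    (hRsym : ∀ t : ℝ, ∀ v w : Euc n, ⟪R t v, w⟫ = ⟪v, R t w⟫)
    (a : ℝ) (W : Submodule ℝ (Euc n)) (S : Euc n →ₗ[ℝ] Euc n)
    (hS : ∀ w₁ ∈ W, ∀ w₂ ∈ W, ⟪S w₁, w₂⟫ = ⟪w₁, S w₂⟫) :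
    (∀ J₁ ∈ LJac R a W S, ∀ J₂ ∈ LJac R a W S, om J₁ J₂ 0 = 0) ∧
    Module.finrank ℝ (Submodule.span ℝ (LJac R a W S)) = n := by
  refine ⟨fun J₁ h₁ J₂ h₂ => ?_, ?_⟩
  · rw [h₁.1.om_eq_s5 hRsym h₂.1 0 a, om_eq_zero_of_mem_LJac hS h₁ h₂]
  · have hspan : Submodule.span ℝ (LJac R a W S) = LJacSubmodule R a W S :=
      (LJacSubmodule R a W S).span_eq
    rw [hspan, (LinearEquiv.ofBijective _ (cauchyData_bijective hRcont hRsym a W S)).finrank_eq,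
      Module.finrank_prod, W.finrank_add_finrank_orthogonal, finrank_euclideanSpace_fin]
end
end

section
/- Let L ⊆ 𝒥 be a Lagrangian subspace such that every instant is L-regular, i.e. {J(t) : J ∈ L} = E for every t ∈ ℝ. Then for each t ∈ ℝ there is a unique linear map S_t : E → E (the Riccati operator of L) with S_t(J(t)) = J'(t) for every J ∈ L, and S_t is self-adjoint. -/
open scoped RealInnerProductSpace

noncomputable section

/-- The symplectic pairing of two Jacobi fields does not depend on time. -/
theorem om_eq_om {n : ℕ} {R : ℝ → (Euc n →L[ℝ] Euc n)}
    (hR : ∀ t : ℝ, ∀ v w : Euc n, ⟪R t v, w⟫ = ⟪v, R t w⟫) {J₁ J₂ : ℝ → Euc n}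
    (h₁ : IsJacobi R J₁) (h₂ : IsJacobi R J₂) (s t : ℝ) : om J₁ J₂ s = om J₁ J₂ t := by
  have hderiv : ∀ t, HasDerivAt (om J₁ J₂) 0 t := fun t => by
    have hsub := ((h₁.2.1 t).hasDerivAt.inner ℝ (h₂.1 t).hasDerivAt).sub
      ((h₁.1 t).hasDerivAt.inner ℝ (h₂.2.1 t).hasDerivAt)
    have e₁ := eq_neg_of_add_eq_zero_left (h₁.2.2 t)
    have e₂ := eq_neg_of_add_eq_zero_left (h₂.2.2 t)
    refine hsub.congr_deriv ?_
    rw [e₁, e₂, inner_neg_left, inner_neg_right, hR]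
    ring
  exact is_const_of_deriv_eq_zero (fun t => (hderiv t).differentiableAt)
    (fun t => (hderiv t).deriv) s t

/-- If the values at `t` of the fields in `L` fill the space and `om` vanishes on `L` at `t`,
then the derivative at `t` of a field in `L` depends only on its value at `t`. -/
theorem deriv_eq_of_apply_eq {n : ℕ} {L : Submodule ℝ (ℝ → Euc n)} {t : ℝ}
    (hiso : ∀ J₁ ∈ L, ∀ J₂ ∈ L, om J₁ J₂ t = 0)
    (hreg : ∀ v : Euc n, ∃ J ∈ L, J t = v) {J K : ℝ → Euc n} (hJ : J ∈ L) (hK : K ∈ L)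
    (h : J t = K t) : deriv J t = deriv K t := by
  refine ext_inner_right ℝ fun v => ?_
  obtain ⟨M, hM, rfl⟩ := hreg v
  have hJM := hiso J hJ M hM
  have hKM := hiso K hK M hM
  unfold om at hJM hKM
  rw [h] at hJM
  linarith

theorem stmt_7 {n : ℕ} (hn : 1 ≤ n) (R : ℝ → (Euc n →L[ℝ] Euc n))
    (hRcont : Continuous R)
    (hRsym : ∀ t : ℝ, ∀ v w : Euc n, ⟪R t v, w⟫ = ⟪v, R t w⟫)
    (L : Submodule ℝ (ℝ → Euc n))
    (hLJ : ∀ J ∈ L, IsJacobi R J)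
    (hiso : ∀ J₁ ∈ L, ∀ J₂ ∈ L, om J₁ J₂ 0 = 0)
    (hdim : Module.finrank ℝ L = n)
    (hreg : ∀ t : ℝ, ∀ v : Euc n, ∃ J ∈ L, J t = v) :
    ∀ t : ℝ,
      (∃! S : Euc n →ₗ[ℝ] Euc n, ∀ J ∈ L, S (J t) = deriv J t) ∧
      ∀ S : Euc n →ₗ[ℝ] Euc n, (∀ J ∈ L, S (J t) = deriv J t) →
        ∀ v w : Euc n, ⟪S v, w⟫ = ⟪v, S w⟫ := by
  intro t
  have hiso_t : ∀ J₁ ∈ L, ∀ J₂ ∈ L, om J₁ J₂ t = 0 := fun J₁ h₁ J₂ h₂ =>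
    (om_eq_om hRsym (hLJ J₁ h₁) (hLJ J₂ h₂) t 0).trans (hiso J₁ h₁ J₂ h₂)
  refine ⟨?_, fun S hS v w => ?_⟩
  · choose F hFL hFt using hreg t
    let S : Euc n →ₗ[ℝ] Euc n :=
      { toFun := fun v => deriv (F v) t
        map_add' := fun v w => by
          rw [← deriv_add ((hLJ _ (hFL v)).1 t) ((hLJ _ (hFL w)).1 t)]
          exact deriv_eq_of_apply_eq hiso_t (hreg t) (hFL _) (L.add_mem (hFL v) (hFL w))
            (by simp [hFt])
        map_smul' := fun c v => by
          rw [RingHom.id_apply, ← deriv_const_smul c ((hLJ _ (hFL v)).1 t)]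
          exact deriv_eq_of_apply_eq hiso_t (hreg t) (hFL _) (L.smul_mem c (hFL v))
            (by simp [hFt]) }
    refine ⟨S, fun J hJ => deriv_eq_of_apply_eq hiso_t (hreg t) (hFL _) hJ (hFt _),
      fun T hT => LinearMap.ext fun v => ?_⟩
    conv_lhs => rw [← hFt v]
    exact hT _ (hFL v)
  · obtain ⟨J, hJ, rfl⟩ := hreg t v
    obtain ⟨K, hK, rfl⟩ := hreg t w
    rw [hS J hJ, hS K hK]
    exact sub_eq_zero.mp (hiso_t J hJ K hK)
end
end

section
/- Let L ⊆ 𝒥 be a Lagrangian subspace with {J(t) : J ∈ L} = E for every t ∈ ℝ, and let S_t : E → E be its Riccati operator, characterized by S_t(J(t)) = J'(t) for all J ∈ L. Then t ↦ S_t is differentiable and satisfies the Riccati equation S_t' + S_t ∘ S_t + R(t) = 0 for all t ∈ ℝ; moreover L = {J : ℝ → E : J is differentiable and J'(t) = S_t(J(t)) for all t ∈ ℝ}. -/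
open scoped RealInnerProductSpace

noncomputable section

/-- The operator `v ↦ ∑ i, v i • f i` whose columns are the vectors `f i`. -/
def ofColumns (n : ℕ) : (Fin n → Euc n) →L[ℝ] (Euc n →L[ℝ] Euc n) :=
  ∑ i, (ContinuousLinearMap.smulRightL ℝ (Euc n) (Euc n) (EuclideanSpace.proj i)).comp
    (ContinuousLinearMap.proj i)

theorem ofColumns_apply {n : ℕ} (f : Fin n → Euc n) (v : Euc n) :
    ofColumns n f v = ∑ i, v i • f i := by
  simp [ofColumns]

theorem ofColumns_eq_apply {n : ℕ} {L : Submodule ℝ (ℝ → Euc n)} (b : Module.Basis (Fin n) ℝ L)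
    (t : ℝ) (v : Euc n) :
    ofColumns n (fun i => (b i : ℝ → Euc n) t) v = (∑ i, v i • b i : L).1 t := by
  simp [ofColumns_apply, Finset.sum_apply]

theorem isUnit_ofColumns {n : ℕ} {L : Submodule ℝ (ℝ → Euc n)} (b : Module.Basis (Fin n) ℝ L)
    {t : ℝ} (ht : ∀ v : Euc n, ∃ J ∈ L, J t = v) :
    IsUnit (ofColumns n fun i => (b i : ℝ → Euc n) t) := by
  have hsurj : Function.Surjective (ofColumns n fun i => (b i : ℝ → Euc n) t) := by
    intro v
    obtain ⟨J, hJ, rfl⟩ := ht v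
    refine ⟨WithLp.toLp 2 (b.repr ⟨J, hJ⟩), ?_⟩
    rw [ofColumns_eq_apply]
    simp only [b.sum_repr]
  rw [ContinuousLinearMap.isUnit_iff_bijective]
  exact ⟨LinearMap.injective_iff_surjective
    (f := (ofColumns n fun i => (b i : ℝ → Euc n) t).toLinearMap).2 hsurj, hsurj⟩

theorem hasDerivAt_ofColumns {n : ℕ} {f : Fin n → ℝ → Euc n} {f' : Fin n → Euc n} {t : ℝ}
    (h : ∀ i, HasDerivAt (f i) (f' i) t) :
    HasDerivAt (fun s => ofColumns n fun i => f i s) (ofColumns n f') t :=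
  (ofColumns n).hasFDerivAt.comp_hasDerivAt t (hasDerivAt_pi.2 h)

theorem mul_ofColumns {n : ℕ} (B : Euc n →L[ℝ] Euc n) (f : Fin n → Euc n) :
    B * ofColumns n f = ofColumns n fun i => B (f i) := by
  ext1 v
  simp [ofColumns_apply]

theorem stmt_8 {n : ℕ} (hn : 1 ≤ n) (R : ℝ → (Euc n →L[ℝ] Euc n))
    (hRcont : Continuous R)
    (hRsym : ∀ t : ℝ, ∀ v w : Euc n, ⟪R t v, w⟫ = ⟪v, R t w⟫)
    (L : Submodule ℝ (ℝ → Euc n))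
    (hLJ : ∀ J ∈ L, IsJacobi R J)
    (hiso : ∀ J₁ ∈ L, ∀ J₂ ∈ L, om J₁ J₂ 0 = 0)
    (hdim : Module.finrank ℝ L = n)
    (hreg : ∀ t : ℝ, ∀ v : Euc n, ∃ J ∈ L, J t = v)
    (S : ℝ → (Euc n →L[ℝ] Euc n))
    (hS : ∀ t : ℝ, ∀ J ∈ L, S t (J t) = deriv J t) :
    Differentiable ℝ S ∧
    (∀ t : ℝ, deriv S t + (S t).comp (S t) + R t = 0) ∧
    (L : Set (ℝ → Euc n)) =
      {J : ℝ → Euc n | Differentiable ℝ J ∧ ∀ t : ℝ, deriv J t = S t (J t)} := by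
  have : FiniteDimensional ℝ L := FiniteDimensional.of_finrank_pos (by omega)
  let b : Module.Basis (Fin n) ℝ L := Module.finBasisOfFinrankEq ℝ L hdim
  have hb : ∀ i, IsJacobi R (b i : ℝ → Euc n) := fun i => hLJ _ (b i).2
  set A : ℝ → (Euc n →L[ℝ] Euc n) := fun t => ofColumns n fun i => (b i : ℝ → Euc n) t with hA
  have hunit : ∀ t, IsUnit (A t) := fun t => isUnit_ofColumns b (hreg t)
  have hSA : ∀ t, S t * A t = ofColumns n fun i => deriv (b i : ℝ → Euc n) t := fun t => by
    simp only [hA, mul_ofColumns, hS t _ (b _).2]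
  have hA' : ∀ t, HasDerivAt A (S t * A t) t := fun t => by
    rw [hSA]
    exact hasDerivAt_ofColumns fun i => ((hb i).1 t).hasDerivAt
  have hA'' : ∀ t, HasDerivAt (fun s => S s * A s) (-(R t * A t)) t := fun t => by
    have h : -(R t * A t) = ofColumns n fun i => deriv (deriv (b i : ℝ → Euc n)) t := by
      simp only [hA, mul_ofColumns, ← map_neg]
      congr 1
      funext i
      exact (eq_neg_of_add_eq_zero_left ((hb i).2.2 t)).symm
    rw [h, funext hSA]
    exact hasDerivAt_ofColumns fun i => ((hb i).2.1 t).hasDerivAt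
  have hinv : Differentiable ℝ fun t => Ring.inverse (A t) := fun t => by
    obtain ⟨u, hu⟩ := hunit t
    have h := hasFDerivAt_ringInverse (𝕜 := ℝ) u
    rw [hu] at h
    exact (h.comp_hasDerivAt t (hA' t)).differentiableAt
  have hSdiff : Differentiable ℝ S := by
    have h : S = fun t => S t * A t * Ring.inverse (A t) := by
      funext t
      rw [mul_assoc, Ring.mul_inverse_cancel _ (hunit t), mul_one]
    rw [h]
    exact fun t => (hA'' t).differentiableAt.mul (hinv t)
  refine ⟨hSdiff, fun t => ?_, ?_⟩
  · have h := ((hSdiff t).hasDerivAt.mul (hA' t)).unique (hA'' t)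
    refine (hunit t).mul_left_eq_zero.1 ?_
    change (deriv S t + S t * S t + R t) * A t = 0
    rw [add_mul, add_mul, mul_assoc, h, neg_add_cancel]
  · ext J
    refine ⟨fun hJ => ⟨(hLJ J hJ).1, fun t => (hS t J hJ).symm⟩, fun ⟨hJ, hJ'⟩ => ?_⟩
    set c : ℝ → Euc n := fun t => Ring.inverse (A t) (J t)
    have hAc : ∀ t, A t (c t) = J t := fun t =>
      DFunLike.congr_fun (Ring.mul_inverse_cancel _ (hunit t)) (J t)
    have hcdiff : Differentiable ℝ c := fun t => (hinv t).clm_apply (hJ t)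
    have hc' : ∀ t, deriv c t = 0 := fun t => by
      have h := (hA' t).clm_apply (hcdiff t).hasDerivAt
      rw [funext hAc] at h
      have h₂ := h.unique (hJ t).hasDerivAt
      rw [hJ' t, mul_apply_eq_comp, hAc, add_eq_left] at h₂
      exact (ContinuousLinearMap.isUnit_iff_bijective.1 (hunit t)).1 (h₂.trans (map_zero _).symm)
    have hJc : J = (∑ i, c 0 i • b i : L).1 := by
      funext t
      rw [← ofColumns_eq_apply, ← hAc t, is_const_of_deriv_eq_zero hcdiff hc' t 0]
    rw [hJc]
    exact (∑ i, c 0 i • b i : L).2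
end
end

section
/- Let x : ℝ → ℝ be differentiable and r : ℝ → ℝ be a function with r(t) ≥ 0 for all t ∈ ℝ, and suppose x'(t) + x(t)² + r(t) = 0 for all t ∈ ℝ. Then x(t) = 0 for all t ∈ ℝ, and consequently r(t) = 0 for all t ∈ ℝ. (A scalar Riccati equation with nonnegative potential admits no globally defined solution other than the zero solution.) -/
/-- A global solution of the differential inequality `x' ≤ -x²` is nonnegative: a negative value
would force blow-up in finite forward time. -/
theorem nonneg_of_deriv_le_neg_sq {x : ℝ → ℝ} (hx : Differentiable ℝ x)
    (h : ∀ t, deriv x t ≤ -x t ^ 2) (a : ℝ) : 0 ≤ x a := by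
  by_contra! ha
  have hanti : Antitone x :=
    antitone_of_deriv_nonpos hx fun t => (h t).trans (neg_nonpos.2 (sq_nonneg _))
  have hneg : ∀ t ∈ Set.Ici a, x t < 0 := fun t ht => (hanti ht).trans_lt ha
  have hd : ∀ t ∈ Set.Ici a,
      HasDerivAt (fun s => (x s)⁻¹ - s) (-deriv x t / x t ^ 2 - 1) t := fun t ht =>
    ((hx t).hasDerivAt.fun_inv (hneg t ht).ne).sub (hasDerivAt_id t)
  have hmono : MonotoneOn (fun s => (x s)⁻¹ - s) (Set.Ici a) := by
    refine monotoneOn_of_deriv_nonneg (convex_Ici a)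
      (fun t ht => (hd t ht).continuousAt.continuousWithinAt)
      (fun t ht => (hd t (interior_subset ht)).differentiableAt.differentiableWithinAt)
      fun t ht => ?_
    have ht' := interior_subset ht
    rw [(hd t ht').deriv, sub_nonneg, one_le_div (sq_pos_of_neg (hneg t ht'))]
    linarith [h t]
  have hinv : (x a)⁻¹ < 0 := inv_lt_zero.2 ha
  have hb : a - (x a)⁻¹ ∈ Set.Ici a := by
    simp only [Set.mem_Ici]
    linarith
  have hle := hmono Set.self_mem_Ici hb hb
  have hlt := inv_lt_zero.2 (hneg _ hb)
  simp only at hle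
  linarith

theorem stmt_11 (x r : ℝ → ℝ)
    (hx : Differentiable ℝ x)
    (hr : ∀ t : ℝ, 0 ≤ r t)
    (heq : ∀ t : ℝ, deriv x t + x t ^ 2 + r t = 0) :
    (∀ t : ℝ, x t = 0) ∧ (∀ t : ℝ, r t = 0) := by
  have h : ∀ t, deriv x t ≤ -x t ^ 2 := fun t => by linarith [hr t, heq t]
  have hzero : ∀ t, x t = 0 := fun t => by
    have hreflect : ∀ s, HasDerivAt (fun s => -x (-s)) (deriv x (-s)) s := fun s => by
      simpa using ((hx (-s)).hasDerivAt.scomp s (hasDerivAt_neg s)).fun_neg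
    have hnonpos := nonneg_of_deriv_le_neg_sq (fun s => (hreflect s).differentiableAt)
      (fun s => by rw [(hreflect s).deriv, neg_sq]; exact h (-s)) (-t)
    rw [neg_neg] at hnonpos
    linarith [nonneg_of_deriv_le_neg_sq hx h t]
  refine ⟨hzero, fun t => ?_⟩
  obtain rfl : x = fun _ => 0 := funext hzero
  simpa using heq t
end

section
/- Let X : ℝ → (E →L[ℝ] E) be a differentiable family of self-adjoint operators satisfying X'(t) + X(t) ∘ X(t) + R(t) = 0 for all t ∈ ℝ, and suppose tr(R(t)) ≥ 0 for all t ∈ ℝ. Then X(t) = 0 for all t ∈ ℝ, and tr(R(t)) = 0 for all t ∈ ℝ. -/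
open scoped RealInnerProductSpace

noncomputable section

/-- The trace of a continuous linear operator on `ℝ^n`. -/
def trOp {n : ℕ} (A : Euc n →L[ℝ] Euc n) : ℝ :=
  LinearMap.trace ℝ (Euc n) (A : Euc n →ₗ[ℝ] Euc n)

/-- A global solution of `f' ≤ -c f²` with `c > 0` is nowhere negative. -/
theorem nonneg_of_deriv_le_neg_mul_sq {f f' : ℝ → ℝ} {c : ℝ} (hc : 0 < c)
    (hf : ∀ t, HasDerivAt f (f' t) t) (hf' : ∀ t, f' t ≤ -c * f t ^ 2) (a : ℝ) : 0 ≤ f a := by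
  by_contra! ha
  have hanti : Antitone f :=
    antitone_of_hasDerivAt_nonpos hf fun t =>
      (hf' t).trans (by simpa using mul_nonneg hc.le (sq_nonneg (f t)))
  have hneg : ∀ t, a ≤ t → f t < 0 := fun t ht => (hanti ht).trans_lt ha
  have hinv : ∀ t, a ≤ t → HasDerivAt (fun s => (f s)⁻¹) (-f' t / f t ^ 2) t := fun t ht =>
    (hf t).fun_inv (hneg t ht).ne
  have hab : a ≤ a - (f a)⁻¹ / c := by
    have := div_nonpos_of_nonpos_of_nonneg (inv_nonpos.2 ha.le) hc.le
    linarith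
  have key := (convex_Ici a).mul_sub_le_image_sub_of_le_deriv
    (f := fun s => (f s)⁻¹) (C := c)
    (fun t ht => (hinv t ht).continuousAt.continuousWithinAt)
    (fun t ht => (hinv t (interior_subset ht)).differentiableAt.differentiableWithinAt)
    (fun t ht => by
      have ht' : a ≤ t := interior_subset ht
      rw [(hinv t ht').deriv, le_div_iff₀ (sq_pos_of_neg (hneg t ht'))]
      linarith [hf' t])
    a Set.self_mem_Ici (a - (f a)⁻¹ / c) hab hab
  have hlt := inv_lt_zero.2 (hneg _ hab)
  have hmul : c * (a - (f a)⁻¹ / c - a) = -(f a)⁻¹ := by field_simp; ring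
  simp only [hmul] at key
  linarith

/-- The only global solution of `f' ≤ -c f²` with `c > 0` is `f = 0`. -/
theorem eq_zero_of_deriv_le_neg_mul_sq {f f' : ℝ → ℝ} {c : ℝ} (hc : 0 < c)
    (hf : ∀ t, HasDerivAt f (f' t) t) (hf' : ∀ t, f' t ≤ -c * f t ^ 2) (a : ℝ) : f a = 0 := by
  refine le_antisymm ?_ (nonneg_of_deriv_le_neg_mul_sq hc hf hf' a)
  have hderiv : ∀ t, HasDerivAt (fun s => -f (-s)) (f' (-t)) t := fun t => by
    simpa using ((hf (-t)).comp t (hasDerivAt_neg t)).fun_neg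
  have := nonneg_of_deriv_le_neg_mul_sq hc hderiv (fun t => by simpa using hf' (-t)) (-a)
  simpa using this

theorem trOp_eq_sum_inner {n : ℕ} (A : Euc n →L[ℝ] Euc n) :
    trOp A = ∑ i, ⟪EuclideanSpace.basisFun (Fin n) ℝ i, A (EuclideanSpace.basisFun (Fin n) ℝ i)⟫ :=
  LinearMap.trace_eq_sum_inner _ (EuclideanSpace.basisFun (Fin n) ℝ)

theorem trOp_add {n : ℕ} (A B : Euc n →L[ℝ] Euc n) : trOp (A + B) = trOp A + trOp B := by
  simp [trOp]

theorem trOp_comp_self_eq_sum_norm_sq {n : ℕ} {A : Euc n →L[ℝ] Euc n}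
    (hA : ∀ v w : Euc n, ⟪A v, w⟫ = ⟪v, A w⟫) :
    trOp (A.comp A) = ∑ i, ‖A (EuclideanSpace.basisFun (Fin n) ℝ i)‖ ^ 2 := by
  rw [trOp_eq_sum_inner]
  refine Finset.sum_congr rfl fun i _ => ?_
  rw [ContinuousLinearMap.comp_apply, ← hA, real_inner_self_eq_norm_sq]

theorem trOp_sq_le {n : ℕ} {A : Euc n →L[ℝ] Euc n}
    (hA : ∀ v w : Euc n, ⟪A v, w⟫ = ⟪v, A w⟫) :
    trOp A ^ 2 ≤ n * trOp (A.comp A) := by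
  rw [trOp_comp_self_eq_sum_norm_sq hA, trOp_eq_sum_inner]
  refine sq_sum_le_card_mul_sum_sq.trans ?_
  rw [Finset.card_univ, Fintype.card_fin]
  refine mul_le_mul_of_nonneg_left (Finset.sum_le_sum fun i _ => ?_) n.cast_nonneg
  have h := abs_real_inner_le_norm (EuclideanSpace.basisFun (Fin n) ℝ i)
    (A (EuclideanSpace.basisFun (Fin n) ℝ i))
  rw [OrthonormalBasis.norm_eq_one, one_mul] at h
  exact sq_le_sq.2 (h.trans (le_abs_self _))

theorem eq_zero_of_trOp_comp_self_eq_zero {n : ℕ} {A : Euc n →L[ℝ] Euc n}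
    (hA : ∀ v w : Euc n, ⟪A v, w⟫ = ⟪v, A w⟫) (h : trOp (A.comp A) = 0) : A = 0 := by
  rw [trOp_comp_self_eq_sum_norm_sq hA,
    Finset.sum_eq_zero_iff_of_nonneg fun _ _ => sq_nonneg _] at h
  refine ContinuousLinearMap.coe_injective
    ((EuclideanSpace.basisFun (Fin n) ℝ).toBasis.ext fun i => ?_)
  simpa using h i (Finset.mem_univ i)

theorem HasDerivAt.trOp {n : ℕ} {X : ℝ → (Euc n →L[ℝ] Euc n)} {X' : Euc n →L[ℝ] Euc n} {t : ℝ}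
    (h : HasDerivAt X X' t) : HasDerivAt (fun s => _root_.trOp (X s)) (_root_.trOp X') t := by
  simp only [trOp_eq_sum_inner]
  refine HasDerivAt.fun_sum fun i _ => ?_
  simpa using (hasDerivAt_const t _).inner ℝ (h.clm_apply (hasDerivAt_const t _))

theorem stmt_12 {n : ℕ} (hn : 1 ≤ n) (R : ℝ → (Euc n →L[ℝ] Euc n))
    (hRcont : Continuous R)
    (hRsym : ∀ t : ℝ, ∀ v w : Euc n, ⟪R t v, w⟫ = ⟪v, R t w⟫)
    (X : ℝ → (Euc n →L[ℝ] Euc n))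
    (hXdiff : Differentiable ℝ X)
    (hXsym : ∀ t : ℝ, ∀ v w : Euc n, ⟪X t v, w⟫ = ⟪v, X t w⟫)
    (hricc : ∀ t : ℝ, deriv X t + (X t).comp (X t) + R t = 0)
    (hRtr : ∀ t : ℝ, 0 ≤ trOp (R t)) :
    (∀ t : ℝ, X t = 0) ∧ (∀ t : ℝ, trOp (R t) = 0) := by
  have hderiv : ∀ t, HasDerivAt (fun s => trOp (X s)) (trOp (deriv X t)) t := fun t =>
    (hXdiff t).hasDerivAt.trOp
  have htr : ∀ t, trOp (deriv X t) + trOp ((X t).comp (X t)) + trOp (R t) = 0 := fun t => by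
    rw [← trOp_add, ← trOp_add, hricc t]
    simp [trOp]
  have hn' : (0 : ℝ) < n := by exact_mod_cast hn
  have hzero : ∀ t, trOp (X t) = 0 := eq_zero_of_deriv_le_neg_mul_sq (inv_pos.2 hn') hderiv
    fun t => by
      have h : (n : ℝ)⁻¹ * trOp (X t) ^ 2 ≤ trOp ((X t).comp (X t)) :=
        (inv_mul_le_iff₀ hn').2 (trOp_sq_le (hXsym t))
      linarith [htr t, hRtr t]
  have hderiv_zero : ∀ t, trOp (deriv X t) = 0 := fun t => by
    have h := hderiv t
    simp only [hzero] at h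
    exact h.unique (hasDerivAt_const t 0)
  have hsq : ∀ t, 0 ≤ trOp ((X t).comp (X t)) := fun t => by
    rw [trOp_comp_self_eq_sum_norm_sq (hXsym t)]
    positivity
  exact ⟨fun t => eq_zero_of_trOp_comp_self_eq_zero (hXsym t)
      (by linarith [htr t, hRtr t, hsq t, hderiv_zero t]),
    fun t => by linarith [htr t, hRtr t, hsq t, hderiv_zero t]⟩
end
end

section
/- Let L ⊆ 𝒥 be a Lagrangian subspace, let ℐ := span{J ∈ L : J(t) = 0 for some t ∈ ℝ}, and for each t ∈ ℝ let V_t := {J(t) : J ∈ ℐ} + {J'(t) : J ∈ ℐ, J(t) = 0}. Then ℐ = {J ∈ L : J(t) ∈ V_t for some t ∈ ℝ}. -/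
open scoped RealInnerProductSpace

noncomputable section

/-- The span of the Jacobi fields in `L` vanishing somewhere. -/
def spanZero {n : ℕ} (L : Submodule ℝ (ℝ → Euc n)) : Submodule ℝ (ℝ → Euc n) :=
  Submodule.span ℝ {J : ℝ → Euc n | J ∈ L ∧ ∃ t : ℝ, J t = 0}

/-- The fiber at time `t` of the vertical bundle associated with a space `I` of
Jacobi fields: `I(t) + D(I_t⁰)(t)`. -/
def vertFib {n : ℕ} (I : Submodule ℝ (ℝ → Euc n)) (t : ℝ) : Set (Euc n) :=
  {v | ∃ J ∈ I, ∃ J' ∈ I, J' t = 0 ∧ v = J t + deriv J' t}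

/-- The symplectic pairing of two Jacobi fields does not depend on time. -/
theorem om_eq_of_isJacobi {n : ℕ} {R : ℝ → (Euc n →L[ℝ] Euc n)}
    (hRsym : ∀ t : ℝ, ∀ v w : Euc n, ⟪R t v, w⟫ = ⟪v, R t w⟫)
    {J₁ J₂ : ℝ → Euc n} (h₁ : IsJacobi R J₁) (h₂ : IsJacobi R J₂) (s t : ℝ) :
    om J₁ J₂ s = om J₁ J₂ t := by
  have hderiv : ∀ x, HasDerivAt (om J₁ J₂) 0 x := by
    intro x
    have h := ((h₁.2.1 x).hasDerivAt.inner ℝ (h₂.1 x).hasDerivAt).sub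
      ((h₁.1 x).hasDerivAt.inner ℝ (h₂.2.1 x).hasDerivAt)
    refine h.congr_deriv ?_
    rw [eq_neg_of_add_eq_zero_left (h₁.2.2 x), eq_neg_of_add_eq_zero_left (h₂.2.2 x),
      inner_neg_left, inner_neg_right, hRsym]
    ring
  exact is_const_of_deriv_eq_zero (fun x => (hderiv x).differentiableAt)
    (fun x => (hderiv x).deriv) s t

theorem spanZero_le {n : ℕ} (L : Submodule ℝ (ℝ → Euc n)) : spanZero L ≤ L :=
  Submodule.span_le.2 fun _ hJ => hJ.1

theorem stmt_14 {n : ℕ} (hn : 1 ≤ n) (R : ℝ → (Euc n →L[ℝ] Euc n))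
    (hRcont : Continuous R)
    (hRsym : ∀ t : ℝ, ∀ v w : Euc n, ⟪R t v, w⟫ = ⟪v, R t w⟫)
    (L : Submodule ℝ (ℝ → Euc n))
    (hLJ : ∀ J ∈ L, IsJacobi R J)
    (hiso : ∀ J₁ ∈ L, ∀ J₂ ∈ L, om J₁ J₂ 0 = 0)
    (hdim : Module.finrank ℝ L = n) :
    (spanZero L : Set (ℝ → Euc n)) =
      {J : ℝ → Euc n | J ∈ L ∧ ∃ t : ℝ, J t ∈ vertFib (spanZero L) t} := by
  ext J
  constructor
  · intro hJ
    exact ⟨spanZero_le L hJ, 0, J, hJ, 0, zero_mem _, rfl, by simp⟩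
  · rintro ⟨hJ, t, A, hA, B, hB, hBt, hJt⟩
    have hJA : J - A ∈ L := L.sub_mem hJ (spanZero_le L hA)
    have hBL := spanZero_le L hB
    have hJAt : (J - A) t = deriv B t := by simp [hJt]
    have hom : om (J - A) B t = 0 := by
      rw [om_eq_of_isJacobi hRsym (hLJ _ hJA) (hLJ _ hBL) t 0, hiso _ hJA _ hBL]
    have hB' : deriv B t = 0 := by
      simpa only [om, hBt, hJAt, inner_zero_right, zero_sub, neg_eq_zero,
        inner_self_eq_zero] using hom
    have hmem : J - A ∈ spanZero L := Submodule.subset_span ⟨hJA, t, hJAt.trans hB'⟩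
    exact (Submodule.sub_mem_iff_left _ hA).1 hmem
end
end
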